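/- (Lemma 5(i), reversible multivariate t transition.) Fix d ≥ 1, ν > 0, ρ ∈ (−1, 1), μ ∈ ℝ^d and a symmetric positive-definite d × d matrix Σ. Let t_d(z; m, S, κ) = Γ((κ+d)/2) / (Γ(κ/2) (κπ)^{d/2} det(S)^{1/2}) · (1 + (z − m)ᵀ S⁻¹ (z − m)/κ)^{−(κ+d)/2} denote the d-variate Student-t density with location m, positive-definite scale matrix S and degrees of freedom κ. Define ζ(z) = t_d(z; μ, Σ, ν) and, for each x ∈ ℝ^d, T(z|x) = t_d(z; μ̃(x), Σ̃(x), ν + d) where μ̃(x) = (1−ρ)μ + ρx and Σ̃(x) = (ν/(ν+d)) (1−ρ²) (1 + (x−μ)ᵀ Σ⁻¹ (x−μ)/ν) Σ. Then the detailed-balance identity holds: ζ(x) T(z|x) = ζ(z) T(x|z) for all x, z ∈ ℝ^d; consequently ∫ ζ(x) T(z|x) dx = ζ(z), so the multivariate t density ζ is the invariant density of the transition density T. -/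

import Mathlib

open Matrix MeasureTheory

/-- The `d`-variate Student-t density `t_d(z; m, S, κ)` with location vector `m`,
positive-definite scale matrix `S` and degrees of freedom `κ`. -/
noncomputable def tDensity (d : ℕ) (m : Fin d → ℝ) (S : Matrix (Fin d) (Fin d) ℝ)
    (κ : ℝ) (z : Fin d → ℝ) : ℝ :=
  Real.Gamma ((κ + (d : ℝ)) / 2) /
      (Real.Gamma (κ / 2) * (κ * Real.pi) ^ ((d : ℝ) / 2) * Real.sqrt S.det) *
    (1 + (z - m) ⬝ᵥ (S⁻¹ *ᵥ (z - m)) / κ) ^ (-(κ + (d : ℝ)) / 2)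

lemma t_gauss (d : ℕ) (b : ℝ) :
    ∫ y : Fin d → ℝ, Real.exp (-b * (y ⬝ᵥ y)) = (Real.sqrt (Real.pi / b)) ^ d := by
  have h := MeasureTheory.integral_fintype_prod_volume_eq_pow (ι := Fin d)
    (fun x : ℝ => Real.exp (-b * x ^ 2))
  rw [integral_gaussian, Fintype.card_fin] at h
  rw [← h]
  congr 1
  ext y
  rw [← Real.exp_sum, dotProduct, Finset.mul_sum]
  simp only [pow_two]

lemma t_gauss_int (d : ℕ) (b : ℝ) (hb : 0 < b) :
    Integrable (fun y : Fin d → ℝ => Real.exp (-b * (y ⬝ᵥ y))) := by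
  have h := MeasureTheory.Integrable.fintype_prod (ι := Fin d) (μ := fun _ => volume)
    (f := fun _ (x : ℝ) => Real.exp (-b * x ^ 2)) (fun _ => integrable_exp_neg_mul_sq hb)
  rw [volume_pi]
  refine h.congr (ae_of_all _ fun y => ?_)
  simp only []
  rw [← Real.exp_sum, dotProduct, Finset.mul_sum]
  simp only [pow_two]

lemma t_dot_nonneg {d : ℕ} (y : Fin d → ℝ) : 0 ≤ y ⬝ᵥ y :=
  Finset.sum_nonneg fun i _ => mul_self_nonneg _

lemma t_std (d : ℕ) (κ : ℝ) (hκ : 0 < κ) :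
    ∫ y : Fin d → ℝ, (1 + y ⬝ᵥ y / κ) ^ (-(κ + (d : ℝ)) / 2) =
      Real.Gamma (κ / 2) * (κ * Real.pi) ^ ((d : ℝ) / 2) / Real.Gamma ((κ + (d : ℝ)) / 2) := by
  set a : ℝ := (κ + (d : ℝ)) / 2 with ha
  have hapos : 0 < a := by positivity
  have hG : 0 < Real.Gamma a := Real.Gamma_pos_of_pos hapos
  have hq : ∀ y : Fin d → ℝ, 0 < 1 + y ⬝ᵥ y / κ := fun y => by
    have := t_dot_nonneg y
    positivity
  let f : (Fin d → ℝ) → ℝ → ℝ := fun y s =>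
    s ^ (a - 1) * Real.exp (-((1 + y ⬝ᵥ y / κ) * s))
  have hf : ∀ y s, f y s =
      (s ^ (a - 1) * Real.exp (-s)) * Real.exp (-(s / κ) * (y ⬝ᵥ y)) := by
    intro y s
    simp only [f]
    rw [mul_assoc, ← Real.exp_add]
    congr 2
    ring
  have hinner : ∀ s ∈ Set.Ioi (0 : ℝ), ∫ y, f y s =
      (κ * Real.pi) ^ ((d : ℝ) / 2) * (Real.exp (-s) * s ^ (κ / 2 - 1)) := by
    intro s hs
    have hs' : 0 < s := hs
    simp only [hf]
    rw [integral_const_mul, t_gauss]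
    have e1 : Real.pi / (s / κ) = (κ * Real.pi) / s := by field_simp
    have e2 : a - 1 = (κ / 2 - 1) + (d : ℝ) / 2 := by rw [ha]; ring
    rw [e1, Real.sqrt_eq_rpow, ← Real.rpow_natCast, ← Real.rpow_mul (by positivity),
      Real.div_rpow (by positivity) hs'.le, e2, Real.rpow_add hs',
      show (1 / 2 * (d : ℝ)) = (d : ℝ) / 2 by ring]
    have : 0 < s ^ ((d : ℝ) / 2) := by positivity
    field_simp
  have hint : Integrable (Function.uncurry f)
      ((volume : Measure (Fin d → ℝ)).prod (volume.restrict (Set.Ioi (0 : ℝ)))) := by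
    rw [integrable_prod_iff']
    · constructor
      · filter_upwards [ae_restrict_mem measurableSet_Ioi] with s hs
        have hs' : 0 < s := hs
        simp only [Function.uncurry, hf]
        exact (t_gauss_int d (s / κ) (by positivity)).const_mul _
      · have h0 : IntegrableOn (fun s : ℝ =>
            (κ * Real.pi) ^ ((d : ℝ) / 2) * (Real.exp (-s) * s ^ (κ / 2 - 1))) (Set.Ioi 0) :=
          (Real.GammaIntegral_convergent (by positivity)).const_mul _
        refine Integrable.congr h0 ?_
        filter_upwards [ae_restrict_mem measurableSet_Ioi] with s hs
        have hs' : 0 < s := hs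
        rw [← hinner s hs]
        congr 1
        ext y
        simp only [Function.uncurry, f]
        rw [Real.norm_of_nonneg (by positivity)]
    · apply Measurable.aestronglyMeasurable
      simp only [Function.uncurry_def, f, dotProduct]
      fun_prop
  have hswap := integral_integral_swap hint
  rw [setIntegral_congr_fun measurableSet_Ioi hinner, integral_const_mul,
    ← Real.Gamma_eq_integral (by positivity)] at hswap
  have hl : ∀ y : Fin d → ℝ, ∫ s in Set.Ioi (0 : ℝ), f y s =
      (1 + y ⬝ᵥ y / κ) ^ (-(κ + (d : ℝ)) / 2) * Real.Gamma a := by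
    intro y
    simp only [f]
    rw [Real.integral_rpow_mul_exp_neg_mul_Ioi hapos (hq y), one_div,
      Real.inv_rpow (hq y).le, ← Real.rpow_neg (hq y).le]
    congr 2
    rw [ha]; ring
  simp only [hl] at hswap
  rw [integral_mul_const] at hswap
  rw [eq_div_iff hG.ne', hswap, mul_comm]

lemma t_posDef_fact {d : ℕ} (M : Matrix (Fin d) (Fin d) ℝ) (hM : M.PosDef) :
    ∃ C : Matrix (Fin d) (Fin d) ℝ, M = Cᵀ * C := by
  open scoped MatrixOrder in
  obtain ⟨C, hC⟩ := CStarAlgebra.nonneg_iff_eq_star_mul_self.mp hM.posSemidef.nonneg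
  exact ⟨C, by simpa [Matrix.star_eq_conjTranspose] using hC⟩

lemma t_integral_one (d : ℕ) (m : Fin d → ℝ) (S : Matrix (Fin d) (Fin d) ℝ) (hS : S.PosDef)
    (κ : ℝ) (hκ : 0 < κ) : ∫ z, tDensity d m S κ z = 1 := by
  obtain ⟨C, hC⟩ := t_posDef_fact _ hS.inv
  have hSd := hS.det_pos
  have hdet : C.det * C.det = (S.det)⁻¹ := by
    have := congrArg Matrix.det hC
    rw [Matrix.det_mul, Matrix.det_transpose, Matrix.det_nonsing_inv,
      Ring.inverse_eq_inv'] at this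
    exact this.symm
  have hCd : C.det ≠ 0 := by
    intro h
    rw [h, mul_zero] at hdet
    exact (inv_pos.mpr hSd).ne hdet
  have hsq : Real.sqrt S.det = |C.det⁻¹| := by
    rw [← Real.sqrt_sq_eq_abs]
    congr 1
    rw [inv_pow, pow_two, hdet, inv_inv]
  have hquad : ∀ v : Fin d → ℝ, v ⬝ᵥ (S⁻¹ *ᵥ v) = (C *ᵥ v) ⬝ᵥ (C *ᵥ v) := by
    intro v
    rw [hC, ← Matrix.mulVec_mulVec, Matrix.dotProduct_mulVec, Matrix.vecMul_transpose]
  simp only [tDensity]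
  rw [integral_const_mul]
  rw [integral_sub_right_eq_self
    (fun z : Fin d → ℝ => (1 + z ⬝ᵥ (S⁻¹ *ᵥ z) / κ) ^ (-(κ + (d : ℝ)) / 2)) m]
  simp only [hquad]
  let g : (Fin d → ℝ) → ℝ := fun y => (1 + y ⬝ᵥ y / κ) ^ (-(κ + (d : ℝ)) / 2)
  have hg : Measurable g := by
    simp only [g, dotProduct]
    fun_prop
  have hmap := integral_map (μ := (volume : Measure (Fin d → ℝ))) (φ := Matrix.toLin' C)
    (LinearMap.continuous_of_finiteDimensional _).measurable.aemeasurable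
    (f := g) hg.aestronglyMeasurable
  rw [Real.map_matrix_volume_pi_eq_smul_volume_pi hCd, integral_smul_measure,
    ENNReal.toReal_ofReal (abs_nonneg _)] at hmap
  simp only [g, t_std d κ hκ, Matrix.toLin'_apply, smul_eq_mul] at hmap
  rw [← hmap, hsq]
  have h1 : 0 < Real.Gamma (κ / 2) := Real.Gamma_pos_of_pos (by positivity)
  have h2 : 0 < Real.Gamma ((κ + (d : ℝ)) / 2) := Real.Gamma_pos_of_pos (by positivity)
  have h3 : 0 < (κ * Real.pi) ^ ((d : ℝ) / 2) := by positivity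
  have h4 : 0 < |C.det⁻¹| := abs_pos.mpr (inv_ne_zero hCd)
  generalize |C.det⁻¹| = e at *
  field_simp

lemma t_balance_form (d : ℕ) (ν : ℝ) (hν : 0 < ν) (ρ : ℝ) (hρ : 0 < 1 - ρ ^ 2)
    (μ : Fin d → ℝ) (S : Matrix (Fin d) (Fin d) ℝ) (hS : S.PosDef) (x z : Fin d → ℝ)
    (q : (Fin d → ℝ) → (Fin d → ℝ) → ℝ) (hq : ∀ u v, q u v = u ⬝ᵥ (S⁻¹ *ᵥ v)) :
    tDensity d μ S ν x * tDensity d ((1 - ρ) • μ + ρ • x)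
      (((ν / (ν + (d : ℝ))) * (1 - ρ ^ 2)
          * (1 + (x - μ) ⬝ᵥ (S⁻¹ *ᵥ (x - μ)) / ν)) • S) (ν + (d : ℝ)) z =
    Real.Gamma ((ν + (d : ℝ)) / 2) /
      (Real.Gamma (ν / 2) * (ν * Real.pi) ^ ((d : ℝ) / 2) * Real.sqrt S.det) *
    (Real.Gamma ((ν + (d : ℝ) + (d : ℝ)) / 2) /
      (Real.Gamma ((ν + (d : ℝ)) / 2) * ((ν + (d : ℝ)) * Real.pi) ^ ((d : ℝ) / 2) *
        (((ν / (ν + (d : ℝ))) * (1 - ρ ^ 2)) ^ ((d : ℝ) / 2) * Real.sqrt S.det))) *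
    ((ν * (1 - ρ ^ 2) + q (x - μ) (x - μ) + q (z - μ) (z - μ) - 2 * ρ * q (x - μ) (z - μ)) /
      (ν * (1 - ρ ^ 2))) ^ (-(ν + (d : ℝ) + (d : ℝ)) / 2) := by
  have hpos : ∀ v, 0 ≤ v ⬝ᵥ (S⁻¹ *ᵥ v) := fun v => by
    simpa using hS.inv.posSemidef.dotProduct_mulVec_nonneg v
  have hsymm : ∀ u v, u ⬝ᵥ (S⁻¹ *ᵥ v) = v ⬝ᵥ (S⁻¹ *ᵥ u) := fun u v => by
    have hT : (S⁻¹)ᵀ = S⁻¹ := by simpa using hS.inv.isHermitian.eq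
    rw [dotProduct_comm, ← Matrix.vecMul_transpose, hT, ← Matrix.dotProduct_mulVec]
  simp only [hq]
  set u := x - μ with hu
  set v := z - μ with hv
  have hz : z - ((1 - ρ) • μ + ρ • x) = v - ρ • u := by
    ext i; simp [hu, hv]; ring
  have hdpos : 0 < ν + (d : ℝ) := by positivity
  set k : ℝ := ν / (ν + (d : ℝ)) * (1 - ρ ^ 2) with hk
  have hkpos : 0 < k := by positivity
  have hqu := hpos u
  set A : ℝ := 1 + u ⬝ᵥ (S⁻¹ *ᵥ u) / ν with hA
  have hApos : 0 < A := by positivity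
  have hSd := hS.det_pos
  have hinv : ((k * A) • S)⁻¹ = (k * A)⁻¹ • S⁻¹ := by
    have : IsUnit S.det := hSd.ne'.isUnit
    apply Matrix.inv_eq_right_inv
    rw [Matrix.smul_mul, Matrix.mul_smul, smul_smul, Matrix.mul_nonsing_inv _ this,
      mul_inv_cancel₀ (by positivity), one_smul]
  have hdet : Real.sqrt ((k * A) • S).det =
      A ^ ((d : ℝ) / 2) * (k ^ ((d : ℝ) / 2) * Real.sqrt S.det) := by
    rw [Matrix.det_smul, Fintype.card_fin, Real.sqrt_mul (by positivity), Real.sqrt_eq_rpow,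
      ← Real.rpow_natCast, ← Real.rpow_mul (by positivity),
      Real.mul_rpow hkpos.le hApos.le, show ((d : ℝ) * (1 / 2)) = (d : ℝ) / 2 by ring]
    ring
  have hN : (1 + (v - ρ • u) ⬝ᵥ ((k * A)⁻¹ • S⁻¹) *ᵥ (v - ρ • u) / (ν + (d : ℝ))) =
      ((ν * (1 - ρ ^ 2) + u ⬝ᵥ (S⁻¹ *ᵥ u) + v ⬝ᵥ (S⁻¹ *ᵥ v) - 2 * ρ * u ⬝ᵥ (S⁻¹ *ᵥ v)) /
      (ν * (1 - ρ ^ 2))) / A := by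
    have e : (v - ρ • u) ⬝ᵥ (S⁻¹ *ᵥ (v - ρ • u)) =
        v ⬝ᵥ (S⁻¹ *ᵥ v) - 2 * ρ * u ⬝ᵥ (S⁻¹ *ᵥ v) + ρ ^ 2 * u ⬝ᵥ (S⁻¹ *ᵥ u) := by
      simp only [Matrix.mulVec_sub, Matrix.mulVec_smul, dotProduct_sub, sub_dotProduct,
        dotProduct_smul, smul_dotProduct, smul_eq_mul]
      rw [hsymm v u]; ring
    rw [Matrix.smul_mulVec, dotProduct_smul, smul_eq_mul, e]
    have hAe : u ⬝ᵥ (S⁻¹ *ᵥ u) = ν * (A - 1) := by rw [hA]; field_simp; ring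
    rw [hAe, hk]
    field_simp
    ring
  have hNpos : 0 ≤ (ν * (1 - ρ ^ 2) + u ⬝ᵥ (S⁻¹ *ᵥ u) + v ⬝ᵥ (S⁻¹ *ᵥ v)
      - 2 * ρ * u ⬝ᵥ (S⁻¹ *ᵥ v)) / (ν * (1 - ρ ^ 2)) := by
    have h1 : 0 ≤ (1 + (v - ρ • u) ⬝ᵥ ((k * A)⁻¹ • S⁻¹) *ᵥ (v - ρ • u) / (ν + (d : ℝ))) := by
      rw [Matrix.smul_mulVec, dotProduct_smul, smul_eq_mul]
      have := hpos (v - ρ • u)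
      positivity
    rw [hN] at h1
    by_contra hc
    exact absurd h1 (not_le.mpr (div_neg_of_neg_of_pos (not_le.mp hc) hApos))
  simp only [tDensity, hz, hinv, hdet, hN, ← hu, ← hA]
  rw [Real.div_rpow hNpos hApos.le]
  have eA : A ^ (-(ν + (d : ℝ)) / 2) =
      A ^ ((d : ℝ) / 2) * A ^ (-(ν + (d : ℝ) + (d : ℝ)) / 2) := by
    rw [← Real.rpow_add hApos]; congr 1; ring
  rw [eA]
  have p1 : 0 < A ^ ((d : ℝ) / 2) := by positivity
  have p2 : 0 < A ^ (-(ν + (d : ℝ) + (d : ℝ)) / 2) := by positivity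
  generalize A ^ ((d : ℝ) / 2) = X at *
  generalize A ^ (-(ν + (d : ℝ) + (d : ℝ)) / 2) = Y at *
  have h1 : Real.Gamma (ν / 2) ≠ 0 := (Real.Gamma_pos_of_pos (by positivity)).ne'
  have h2 : Real.Gamma ((ν + (d : ℝ)) / 2) ≠ 0 := (Real.Gamma_pos_of_pos (by positivity)).ne'
  have h3 : (ν * Real.pi) ^ ((d : ℝ) / 2) ≠ 0 := by positivity
  have h4 : ((ν + (d : ℝ)) * Real.pi) ^ ((d : ℝ) / 2) ≠ 0 := by positivity
  have h5 : k ^ ((d : ℝ) / 2) ≠ 0 := by positivity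
  have h6 : Real.sqrt S.det ≠ 0 := by positivity
  generalize Real.Gamma (ν / 2) = g1 at *
  generalize Real.Gamma ((ν + (d : ℝ)) / 2) = g2 at *
  generalize (ν * Real.pi) ^ ((d : ℝ) / 2) = g3 at *
  generalize ((ν + (d : ℝ)) * Real.pi) ^ ((d : ℝ) / 2) = g4 at *
  generalize k ^ ((d : ℝ) / 2) = g5 at *
  generalize Real.sqrt S.det = g6 at *
  generalize (_ / _ : ℝ) ^ (-(ν + (d : ℝ) + (d : ℝ)) / 2) = g7
  field_simp

/-- **Lemma 5(i), reversible multivariate t transition.**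
With `ζ(z) = t_d(z; μ, Σ, ν)` and
`T(z|x) = t_d(z; μ̃(x), Σ̃(x), ν + d)` where `μ̃(x) = (1−ρ)μ + ρx` and
`Σ̃(x) = (ν/(ν+d))(1−ρ²)(1 + (x−μ)ᵀΣ⁻¹(x−μ)/ν) Σ`, detailed balance
`ζ(x)T(z|x) = ζ(z)T(x|z)` holds for all `x, z`; consequently
`∫ ζ(x)T(z|x) dx = ζ(z)`, i.e. `ζ` is the invariant density of `T`.
Here `T z x = T(z|x)`. -/
theorem reversible_t_transition (d : ℕ) (hd : 1 ≤ d)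
    (ν : ℝ) (hν : 0 < ν) (ρ : ℝ) (hρ₁ : -1 < ρ) (hρ₂ : ρ < 1)
    (μ : Fin d → ℝ) (S : Matrix (Fin d) (Fin d) ℝ) (hS : S.PosDef)
    (ζ : (Fin d → ℝ) → ℝ) (hζ : ∀ z, ζ z = tDensity d μ S ν z)
    (T : (Fin d → ℝ) → (Fin d → ℝ) → ℝ)
    (hT : ∀ z x, T z x = tDensity d
      ((1 - ρ) • μ + ρ • x)
      (((ν / (ν + (d : ℝ))) * (1 - ρ ^ 2)
          * (1 + (x - μ) ⬝ᵥ (S⁻¹ *ᵥ (x - μ)) / ν)) • S)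
      (ν + (d : ℝ)) z) :
    (∀ x z, ζ x * T z x = ζ z * T x z) ∧
    (∀ z, ∫ x, ζ x * T z x = ζ z) := by
  have hρ : 0 < 1 - ρ ^ 2 := by nlinarith
  have hbal : ∀ x z, ζ x * T z x = ζ z * T x z := by
    intro x z
    have hsymm : ∀ u v, u ⬝ᵥ (S⁻¹ *ᵥ v) = v ⬝ᵥ (S⁻¹ *ᵥ u) := fun u v => by
      have hT : (S⁻¹)ᵀ = S⁻¹ := by simpa using hS.inv.isHermitian.eq
      rw [dotProduct_comm, ← Matrix.vecMul_transpose, hT, ← Matrix.dotProduct_mulVec]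
    rw [hζ, hζ, hT, hT,
      t_balance_form d ν hν ρ hρ μ S hS x z (fun u v => u ⬝ᵥ (S⁻¹ *ᵥ v)) (fun _ _ => rfl),
      t_balance_form d ν hν ρ hρ μ S hS z x (fun u v => u ⬝ᵥ (S⁻¹ *ᵥ v)) (fun _ _ => rfl)]
    rw [hsymm (z - μ) (x - μ)]
    congr 3
    ring
  refine ⟨hbal, fun z => ?_⟩
  simp only [fun x => hbal x z]
  rw [integral_const_mul]
  simp only [hT]
  have hpos : 0 ≤ (z - μ) ⬝ᵥ (S⁻¹ *ᵥ (z - μ)) := by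
    simpa using hS.inv.posSemidef.dotProduct_mulVec_nonneg (z - μ)
  rw [t_integral_one _ _ _ (hS.smul (by positivity)) _ (by positivity), mul_one]
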